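/- Let k < n be positive integers, K a field, 1 ≤ ℓ ≤ n-1, and v ≤ w in I_{k,n}. Suppose the restricted ideal G_{k,n,ℓ}|_w^v = ker(φ_ℓ)|_{T_w^v} is monomial-free. Then the images in the quotient ring K[P_I : I ∈ T_w^v] / ker(φ_ℓ|_w^v) of the degree-two monomials P_{I'} P_{J'}, where (I',J') = Γ_ℓ(I,J) ranges over all two-column semi-standard Young tableaux (I,J) with v ≤ I ≤ w and v ≤ J ≤ w, form a K-linearly independent set, and every homogeneous polynomial of degree two in K[P_I : I ∈ T_w^v] is congruent modulo ker(φ_ℓ|_w^v) to a K-linear combination of these monomials; i.e., they form a monomial basis of the quotient in degree two. -/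

import Mathlib

open MvPolynomial

/-- `IsIdx n k J` : `J` is a strictly increasing `k`-tuple with entries in `{1, …, n}`,
representing an element `{J 0 < J 1 < … < J (k-1)}` of `I_{k,n}`. -/
def IsIdx (n k : ℕ) (J : Fin k → ℕ) : Prop :=
  StrictMono J ∧ ∀ s, 1 ≤ J s ∧ J s ≤ n

/-- Componentwise (Bruhat) order on sorted tuples. -/
def TupLe {k : ℕ} (I J : Fin k → ℕ) : Prop := ∀ s, I s ≤ J s

/-- Index type of the Plücker variables `P_I`, `I ∈ I_{k,n}`. -/
def PlVar (n k : ℕ) : Type := {J : Fin k → ℕ // IsIdx n k J}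

/-- The number of entries of `J` lying in `{1, …, ℓ}`. -/
def nSmall {k : ℕ} (ℓ : ℕ) (J : Fin k → ℕ) : ℕ :=
  (Finset.univ.filter fun s => J s ≤ ℓ).card

/-- Row assignment of the block diagonal matching field `B_ℓ` : the entry of `J` in sorted
position `i` (0-indexed) is placed in this (1-indexed) row. -/
def mfRow {k : ℕ} (ℓ : ℕ) (J : Fin k → ℕ) (i : Fin k) : ℕ :=
  if 2 ≤ k ∧ nSmall ℓ J = 1 then
    (if (i : ℕ) = 0 then 2 else if (i : ℕ) = 1 then 1 else (i : ℕ) + 1)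
  else (i : ℕ) + 1

/-- The monomial map `φ_ℓ` of the block diagonal matching field `B_ℓ`. -/
noncomputable def phiMF (K : Type*) [Field K] (n k ℓ : ℕ) :
    MvPolynomial (PlVar n k) K →ₐ[K] MvPolynomial (ℕ × ℕ) K :=
  aeval fun J => ∏ i : Fin k, X (mfRow ℓ J.val i, J.val i)

/-- The Plücker map, sending `P_J` to the `k × k` minor on columns `J`
of the generic matrix `(x_{i,j})`. -/
noncomputable def pluMap (K : Type*) [Field K] (n k : ℕ) :
    MvPolynomial (PlVar n k) K →ₐ[K] MvPolynomial (ℕ × ℕ) K :=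
  aeval fun J =>
    (Matrix.of fun r c : Fin k => (X ((r : ℕ) + 1, J.val c) : MvPolynomial (ℕ × ℕ) K)).det

/-- Restriction `G|_T = (G + ⟨P_I : I ∉ T⟩) ∩ K[P_I : I ∈ T]` of an ideal to the
variables indexed by `T`. -/
noncomputable def restrictIdeal {K : Type*} [Field K] {n k : ℕ}
    (G : Ideal (MvPolynomial (PlVar n k) K)) (T : Set (PlVar n k)) :
    Ideal (MvPolynomial T K) :=
  Ideal.comap (rename fun x : T => (x : PlVar n k))
    (G ⊔ Ideal.span (X '' {J | J ∉ T}))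

/-- An ideal of a polynomial ring is monomial-free if it contains no monomial. -/
def MonomialFree {K : Type*} [Field K] {σ : Type*} (I : Ideal (MvPolynomial σ K)) : Prop :=
  ∀ m : σ →₀ ℕ, (monomial m (1 : K)) ∉ I

/-- `T_w^v = {I ∈ I_{k,n} : v ≤ I ≤ w}`. -/
def TWV {n k : ℕ} (v w : PlVar n k) : Set (PlVar n k) :=
  {J | TupLe v.val J.val ∧ TupLe J.val w.val}

/-- `{I ∈ I_{k,n} : I ≤ w}`. -/
def TleW {n k : ℕ} (w : PlVar n k) : Set (PlVar n k) := {J | TupLe J.val w.val}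

/-- `{I ∈ I_{k,n} : v ≤ I}`. -/
def TgeV {n k : ℕ} (v : PlVar n k) : Set (PlVar n k) := {J | TupLe v.val J.val}

/-- The weight matrix `M_ℓ` (rows and columns 1-indexed). -/
def Mmat (n ℓ : ℕ) (i j : ℕ) : ℤ :=
  if i = 2 then (if j ≤ ℓ then (ℓ : ℤ) - j + 1 else (n : ℤ) - j + ℓ + 1)
  else ((i : ℤ) - 1) * ((n : ℤ) - j + 1)

/-- The weight `w_ℓ(P_J)` induced by `M_ℓ` on the Plücker variable `P_J`. -/
def wVec (n ℓ : ℕ) {k : ℕ} (J : Fin k → ℕ) : ℤ :=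
  ∑ i : Fin k, Mmat n ℓ (mfRow ℓ J i) (J i)

/-- Weight of an exponent vector with respect to a weight vector `u`. -/
def expWt {σ : Type*} (u : σ → ℤ) (m : σ →₀ ℕ) : ℤ := m.sum fun i e => u i * (e : ℤ)

/-- Initial form of a polynomial: the sum of its terms of minimal `u`-weight. -/
noncomputable def initialForm {K σ : Type*} [Field K] (u : σ → ℤ) (f : MvPolynomial σ K) :
    MvPolynomial σ K :=
  ∑ m ∈ f.support.filter (fun m => ∀ m' ∈ f.support, expWt u m ≤ expWt u m'),
    monomial m (coeff m f)

/-- Initial ideal with respect to the weight vector `u`. -/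
noncomputable def initialIdeal {K σ : Type*} [Field K] (u : σ → ℤ)
    (I : Ideal (MvPolynomial σ K)) : Ideal (MvPolynomial σ K) :=
  Ideal.span {g | ∃ f ∈ I, g = initialForm u f}

/-- `w_0 I = {n + 1 - i : i ∈ I}`, as a sorted tuple. -/
def w0t (n : ℕ) {k : ℕ} (I : Fin k → ℕ) : Fin k → ℕ :=
  fun s => n + 1 - I ⟨k - 1 - (s : ℕ), by have := s.isLt; omega⟩

/-- Membership in `Z_{k,n}` : either `J = {1, …, k-1, i}` with `k ≤ i ≤ n`,
or `J = {1, …, k+1} \\ {i}` with `1 ≤ i ≤ k-1`. -/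
def ZPred (n k : ℕ) (J : Fin k → ℕ) : Prop :=
  (∃ i, k ≤ i ∧ i ≤ n ∧
    ∀ s : Fin k, J s = if (s : ℕ) + 1 < k then (s : ℕ) + 1 else i) ∨
  (∃ i, 1 ≤ i ∧ i ≤ k - 1 ∧
    ∀ s : Fin k, J s = if (s : ℕ) + 1 < i then (s : ℕ) + 1 else (s : ℕ) + 2)

/-- A two-column semi-standard Young tableau with columns `I`, `J`. -/
def SSYT (n k : ℕ) (I J : Fin k → ℕ) : Prop :=
  IsIdx n k I ∧ IsIdx n k J ∧ ∀ s, I s ≤ J s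

/-- The map `Γ_ℓ` on two-column semi-standard Young tableaux (columns as sorted tuples). -/
def Gamma (ℓ : ℕ) {k : ℕ} (I J : Fin k → ℕ) : (Fin k → ℕ) × (Fin k → ℕ) :=
  if h : 2 ≤ k then
    let i0 := I ⟨0, by omega⟩
    let i1 := I ⟨1, by omega⟩
    let j0 := J ⟨0, by omega⟩
    let j1 := J ⟨1, by omega⟩
    if (i0 ≤ ℓ ∧ i1 ≤ ℓ ∧ j0 ≤ ℓ ∧ ℓ < j1 ∧ i0 < j0 ∧ j0 < i1) ∨
       (i0 ≤ ℓ ∧ ℓ < i1 ∧ ℓ < j0 ∧ ℓ < j1 ∧ j0 < i1 ∧ i1 < j1) then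
      ((fun s => if (s : ℕ) = 0 then j0 else I s), (fun s => if (s : ℕ) = 0 then i0 else J s))
    else (I, J)
  else (I, J)

/-- A column (a `k`-subset given as a sorted tuple) displayed in `B_ℓ`-order:
when `k ≥ 2` and exactly one entry is `≤ ℓ`, the two smallest entries are swapped. -/
def rowArrange (ℓ : ℕ) {k : ℕ} (C : Fin k → ℕ) : Fin k → ℕ :=
  if h : 2 ≤ k then
    (if nSmall ℓ C = 1 then
      fun s => if (s : ℕ) = 0 then C ⟨1, by omega⟩
        else if (s : ℕ) = 1 then C ⟨0, by omega⟩ else C s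
    else C)
  else C

/-- Two two-column tableaux (with columns `A,B` resp. `C,D`) are row-wise equal. -/
def rowEq {k : ℕ} (A B C D : Fin k → ℕ) : Prop :=
  ∀ s, ({A s, B s} : Multiset ℕ) = {C s, D s}

/-- The kernel of the restricted monomial map `φ_ℓ|_T`. -/
noncomputable def kerPhiRes (K : Type*) [Field K] (n k ℓ : ℕ) (T : Set (PlVar n k)) :
    Ideal (MvPolynomial T K) :=
  RingHom.ker ((phiMF K n k ℓ).comp (rename fun x : T => (x : PlVar n k)))

/-- The ideal `I(X_w^v)` of the Richardson variety: the restriction of the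
Plücker ideal `G_{k,n}` to the variables in `T_w^v`. -/
noncomputable def richIdeal (K : Type*) [Field K] (n k : ℕ) (v w : PlVar n k) :
    Ideal (MvPolynomial (TWV v w) K) :=
  restrictIdeal (RingHom.ker (pluMap K n k)) (TWV v w)

/-- Equality of unordered pairs. -/
def PairEq (a b c d : ℕ) : Prop := (a = c ∧ b = d) ∨ (a = d ∧ b = c)

/-- exponent vector of `φ_ℓ(P_J)`. -/
noncomputable def expo {k : ℕ} (ℓ : ℕ) (J : Fin k → ℕ) : ℕ × ℕ →₀ ℕ :=
  ∑ i : Fin k, Finsupp.single ((i : ℕ) + 1, rowArrange ℓ J i) 1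

theorem nSmall_eq_one {n k ℓ : ℕ} (h : 2 ≤ k) {J : Fin k → ℕ} (hJ : IsIdx n k J) :
    nSmall ℓ J = 1 ↔ J ⟨0, by omega⟩ ≤ ℓ ∧ ℓ < J ⟨1, by omega⟩ := by
  unfold nSmall
  rw [Finset.card_eq_one]
  constructor
  · rintro ⟨a, ha⟩
    have hmem : ∀ s, J s ≤ ℓ ↔ s = a := by
      intro s
      have := congrArg (fun t => s ∈ t) ha
      simpa using this
    have h0 : (⟨0, by omega⟩ : Fin k) = a := by
      rw [← hmem]
      exact (hJ.1.monotone (Fin.mk_le_of_le_val (Nat.zero_le _))).trans ((hmem a).2 rfl)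
    refine ⟨(hmem _).2 h0, ?_⟩
    by_contra hc
    have := (hmem ⟨1, by omega⟩).1 (by omega)
    rw [← h0] at this
    simp at this
  · rintro ⟨h0, h1⟩
    refine ⟨⟨0, by omega⟩, ?_⟩
    ext s
    simp only [Finset.mem_filter, Finset.mem_univ, true_and, Finset.mem_singleton]
    constructor
    · intro hs
      by_contra hne
      have : (⟨1, by omega⟩ : Fin k) ≤ s := by
        rw [Fin.le_def]
        have : (s : ℕ) ≠ 0 := fun h => hne (Fin.ext h)
        simp; omega
      have := hJ.1.monotone this
      omega
    · rintro rfl; exact h0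

theorem ra_one {ℓ : ℕ} {k : ℕ} (h : ¬ 2 ≤ k) (J : Fin k → ℕ) : rowArrange ℓ J = J := by
  simp [rowArrange, h]

theorem ra_zero {n k ℓ : ℕ} (h : 2 ≤ k) {J : Fin k → ℕ} (hJ : IsIdx n k J) :
    rowArrange ℓ J ⟨0, by omega⟩ = if J ⟨0, by omega⟩ ≤ ℓ ∧ ℓ < J ⟨1, by omega⟩
      then J ⟨1, by omega⟩ else J ⟨0, by omega⟩ := by
  simp only [rowArrange, h, dif_pos, nSmall_eq_one h hJ]
  split_ifs <;> simp

theorem ra_fst {n k ℓ : ℕ} (h : 2 ≤ k) {J : Fin k → ℕ} (hJ : IsIdx n k J) :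
    rowArrange ℓ J ⟨1, by omega⟩ = if J ⟨0, by omega⟩ ≤ ℓ ∧ ℓ < J ⟨1, by omega⟩
      then J ⟨0, by omega⟩ else J ⟨1, by omega⟩ := by
  simp only [rowArrange, h, dif_pos, nSmall_eq_one h hJ]
  split_ifs <;> simp

theorem ra_high {k ℓ : ℕ} (J : Fin k → ℕ) (s : Fin k) (hs : 2 ≤ (s : ℕ)) :
    rowArrange ℓ J s = J s := by
  unfold rowArrange
  split_ifs <;> simp <;> grind

theorem phi_X (K : Type*) [Field K] (n k ℓ : ℕ) (J : PlVar n k) :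
    phiMF K n k ℓ (X J) = monomial (expo ℓ J.val) 1 := by
  have h1 : (monomial (expo ℓ J.val) (1 : K)) =
      ∏ i : Fin k, X ((i : ℕ) + 1, rowArrange ℓ J.val i) := by
    unfold expo
    rw [monomial_sum_one]
    rfl
  rw [h1, phiMF, aeval_X]
  by_cases hc : 2 ≤ k ∧ nSmall ℓ J.val = 1
  · obtain ⟨h, hn⟩ := hc
    refine Fintype.prod_equiv (Equiv.swap (⟨0, by omega⟩ : Fin k) ⟨1, by omega⟩) _ _ ?_
    intro i
    congr 1
    by_cases h0 : i = ⟨0, by omega⟩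
    · subst h0
      simp [mfRow, rowArrange, h, hn]
    by_cases h1 : i = ⟨1, by omega⟩
    · subst h1
      simp [mfRow, rowArrange, h, hn]
    rw [Equiv.swap_apply_of_ne_of_ne h0 h1]
    have h0' : (i : ℕ) ≠ 0 := fun h => h0 (Fin.ext h)
    have h1' : (i : ℕ) ≠ 1 := fun h => h1 (Fin.ext h)
    simp [mfRow, rowArrange, h, hn, h0', h1']
  · refine Finset.prod_congr rfl fun i _ => ?_
    have : rowArrange ℓ J.val = J.val := by
      unfold rowArrange
      split_ifs <;> simp_all
    rw [this, mfRow, if_neg hc]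

theorem expo_apply {k : ℕ} (ℓ : ℕ) (J : Fin k → ℕ) (s : Fin k) (x : ℕ) :
    expo ℓ J ((s : ℕ) + 1, x) = if rowArrange ℓ J s = x then 1 else 0 := by
  unfold expo
  rw [Finsupp.finsetSum_apply, Finset.sum_eq_single s]
  · simp [Finsupp.single_apply]
  · intro b _ hb
    rw [Finsupp.single_apply, if_neg]
    simp only [Prod.mk.injEq, not_and]
    intro h
    exact absurd (Fin.ext (by omega)) hb
  · simp

theorem expo_add_eq {k ℓ : ℕ} {A B C D : Fin k → ℕ} :
    expo ℓ A + expo ℓ B = expo ℓ C + expo ℓ D ↔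
      ∀ s, PairEq (rowArrange ℓ A s) (rowArrange ℓ B s) (rowArrange ℓ C s) (rowArrange ℓ D s) := by
  constructor
  · intro h s
    have key : ∀ x, _ := fun x => DFunLike.congr_fun h ((s : ℕ) + 1, x)
    simp only [Finsupp.add_apply, expo_apply] at key
    have k1 := key (rowArrange ℓ A s)
    have k2 := key (rowArrange ℓ B s)
    have k3 := key (rowArrange ℓ C s)
    have k4 := key (rowArrange ℓ D s)
    unfold PairEq
    grind
  · intro h
    unfold expo
    rw [← Finset.sum_add_distrib, ← Finset.sum_add_distrib]
    refine Finset.sum_congr rfl fun s _ => ?_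
    rcases h s with ⟨h1, h2⟩ | ⟨h1, h2⟩
    · rw [h1, h2]
    · rw [h1, h2, add_comm]

/-- The condition under which `Γ_ℓ` swaps. -/
def GC (ℓ i0 i1 j0 j1 : ℕ) : Prop :=
  (i0 ≤ ℓ ∧ i1 ≤ ℓ ∧ j0 ≤ ℓ ∧ ℓ < j1 ∧ i0 < j0 ∧ j0 < i1) ∨
       (i0 ≤ ℓ ∧ ℓ < i1 ∧ ℓ < j0 ∧ ℓ < j1 ∧ j0 < i1 ∧ i1 < j1)

instance (ℓ i0 i1 j0 j1 : ℕ) : Decidable (GC ℓ i0 i1 j0 j1) := by unfold GC; infer_instance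

theorem gamma_one {ℓ k : ℕ} (h : ¬ 2 ≤ k) (I J : Fin k → ℕ) : Gamma ℓ I J = (I, J) := by
  simp [Gamma, h]

theorem gamma_fst {ℓ k : ℕ} (h : 2 ≤ k) (I J : Fin k → ℕ) (s : Fin k) :
    (Gamma ℓ I J).1 s = if GC ℓ (I ⟨0, by omega⟩) (I ⟨1, by omega⟩) (J ⟨0, by omega⟩)
      (J ⟨1, by omega⟩) ∧ (s : ℕ) = 0 then J s else I s := by
  unfold Gamma GC
  rw [dif_pos h]
  dsimp only
  by_cases hs : (s : ℕ) = 0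
  · obtain rfl : s = ⟨0, Nat.lt_of_lt_of_le Nat.zero_lt_two h⟩ := Fin.ext hs
    split_ifs <;> simp_all
  · split_ifs <;> simp_all

theorem gamma_snd {ℓ k : ℕ} (h : 2 ≤ k) (I J : Fin k → ℕ) (s : Fin k) :
    (Gamma ℓ I J).2 s = if GC ℓ (I ⟨0, by omega⟩) (I ⟨1, by omega⟩) (J ⟨0, by omega⟩)
      (J ⟨1, by omega⟩) ∧ (s : ℕ) = 0 then I s else J s := by
  unfold Gamma GC
  rw [dif_pos h]
  dsimp only
  by_cases hs : (s : ℕ) = 0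
  · obtain rfl : s = ⟨0, Nat.lt_of_lt_of_le Nat.zero_lt_two h⟩ := Fin.ext hs
    split_ifs <;> simp_all
  · split_ifs <;> simp_all

/-- entries of `Γ_ℓ(I,J)` are row-wise a permutation of those of `(I,J)` -/
theorem gamma_pair {ℓ k : ℕ} (I J : Fin k → ℕ) (s : Fin k) :
    PairEq ((Gamma ℓ I J).1 s) ((Gamma ℓ I J).2 s) (I s) (J s) := by
  by_cases h : 2 ≤ k
  · rw [gamma_fst h, gamma_snd h]
    unfold PairEq
    split_ifs <;> simp
  · rw [gamma_one h]; simp [PairEq]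

theorem idx_of {n k : ℕ} (h : 2 ≤ k) {I A : Fin k → ℕ} (hA : IsIdx n k A)
    (hhi : ∀ s : Fin k, (s : ℕ) ≠ 0 → I s = A s)
    (h0 : I ⟨0, by omega⟩ < A ⟨1, by omega⟩) (h1 : 1 ≤ I ⟨0, by omega⟩) : IsIdx n k I := by
  constructor
  · intro s t hst
    have ht : (t : ℕ) ≠ 0 := by have := Fin.lt_def.1 hst; omega
    rw [hhi t ht]
    by_cases hs : (s : ℕ) = 0
    · obtain rfl : s = ⟨0, Nat.lt_of_lt_of_le Nat.zero_lt_two h⟩ := Fin.ext hs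
      refine h0.trans_le (hA.1.monotone ?_)
      rw [Fin.le_def]; simp; omega
    · rw [hhi s hs]; exact hA.1 hst
  · intro s
    by_cases hs : (s : ℕ) = 0
    · obtain rfl : s = ⟨0, Nat.lt_of_lt_of_le Nat.zero_lt_two h⟩ := Fin.ext hs
      have := (hA.2 ⟨1, by omega⟩).2
      omega
    · rw [hhi s hs]; exact hA.2 s

theorem gamma_idx {n k ℓ : ℕ} {I J : Fin k → ℕ} (hT : SSYT n k I J) :
    IsIdx n k (Gamma ℓ I J).1 ∧ IsIdx n k (Gamma ℓ I J).2 := by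
  obtain ⟨hI, hJ, hle⟩ := hT
  by_cases h : 2 ≤ k
  · have i01 : I ⟨0, by omega⟩ < I ⟨1, by omega⟩ := hI.1 (by simp [Fin.lt_def])
    have j01 : J ⟨0, by omega⟩ < J ⟨1, by omega⟩ := hJ.1 (by simp [Fin.lt_def])
    have l0 := hle ⟨0, by omega⟩
    have i0 := hI.2 ⟨0, by omega⟩
    have j0 := hJ.2 ⟨0, by omega⟩
    constructor
    · refine idx_of h hI (fun s hs => by rw [gamma_fst h, if_neg (by tauto)]) ?_ ?_
      · rw [gamma_fst h]
        split_ifs with hc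
        · have := hc.1; unfold GC at this; omega
        · exact i01
      · rw [gamma_fst h]; split_ifs <;> omega
    · refine idx_of h hJ (fun s hs => by rw [gamma_snd h, if_neg (by tauto)]) ?_ ?_
      · rw [gamma_snd h]
        split_ifs with hc <;> omega
      · rw [gamma_snd h]; split_ifs <;> omega
  · rw [gamma_one h]; exact ⟨hI, hJ⟩

theorem num_inj (ℓ i0 i1 j0 j1 a0 a1 b0 b1 : ℕ) (h1 : i0 < i1) (h2 : j0 < j1) (h3 : i0 ≤ j0)
    (h4 : i1 ≤ j1) (h1' : a0 < a1) (h2' : b0 < b1) (h3' : a0 ≤ b0) (h4' : a1 ≤ b1)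
    (p q p' q' : ℕ)
    (hp : p = if GC ℓ i0 i1 j0 j1 then j0 else i0)
    (hq : q = if GC ℓ i0 i1 j0 j1 then i0 else j0)
    (hp' : p' = if GC ℓ a0 a1 b0 b1 then b0 else a0)
    (hq' : q' = if GC ℓ a0 a1 b0 b1 then a0 else b0)
    (e0 : PairEq (if p ≤ ℓ ∧ ℓ < i1 then i1 else p) (if q ≤ ℓ ∧ ℓ < j1 then j1 else q)
      (if p' ≤ ℓ ∧ ℓ < a1 then a1 else p') (if q' ≤ ℓ ∧ ℓ < b1 then b1 else q'))
    (e1 : PairEq (if p ≤ ℓ ∧ ℓ < i1 then p else i1) (if q ≤ ℓ ∧ ℓ < j1 then q else j1)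
      (if p' ≤ ℓ ∧ ℓ < a1 then p' else a1) (if q' ≤ ℓ ∧ ℓ < b1 then q' else b1)) :
    i0 = a0 ∧ i1 = a1 ∧ j0 = b0 ∧ j1 = b1 := by
  unfold PairEq at e0 e1
  by_cases g : GC ℓ i0 i1 j0 j1 <;> by_cases g' : GC ℓ a0 a1 b0 b1 <;>
    simp only [g, g', if_true, if_false] at hp hq hp' hq' <;> subst hp hq hp' hq' <;>
    unfold GC at g g' <;> split_ifs at e0 e1 <;> omega

theorem num_ex (ℓ a0 a1 b0 b1 : ℕ) (ha : a0 < a1) (hb : b0 < b1) (ha' : 1 ≤ a0) (hb' : 1 ≤ b0) :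
    ∃ i0 i1 j0 j1, 1 ≤ i0 ∧ i0 < i1 ∧ j0 < j1 ∧ i0 ≤ j0 ∧ i1 ≤ j1 ∧ i1 ≤ a1 ∧ i1 ≤ b1 ∧
      j1 ≤ max a1 b1 ∧
      ∀ p q, (GC ℓ i0 i1 j0 j1 ∧ p = j0 ∧ q = i0) ∨ (¬ GC ℓ i0 i1 j0 j1 ∧ p = i0 ∧ q = j0) →
        PairEq (if a0 ≤ ℓ ∧ ℓ < a1 then a1 else a0) (if b0 ≤ ℓ ∧ ℓ < b1 then b1 else b0)
          (if p ≤ ℓ ∧ ℓ < i1 then i1 else p) (if q ≤ ℓ ∧ ℓ < j1 then j1 else q) ∧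
        PairEq (if a0 ≤ ℓ ∧ ℓ < a1 then a0 else a1) (if b0 ≤ ℓ ∧ ℓ < b1 then b0 else b1)
          (if p ≤ ℓ ∧ ℓ < i1 then p else i1) (if q ≤ ℓ ∧ ℓ < j1 then q else j1) := by
  unfold PairEq GC at *
  by_cases hA : a0 ≤ ℓ ∧ ℓ < a1 <;> by_cases hB : b0 ≤ ℓ ∧ ℓ < b1
  · refine ⟨(min a0 b0), (min a1 b1), (max a0 b0), (max a1 b1), ?_⟩
    refine ⟨by omega, by omega, by omega, by omega, by omega, by omega, by omega, by omega, ?_⟩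
    rintro p q hp
    split_ifs <;> omega
  · by_cases c1 : ℓ < b0
    · by_cases c2 : b0 < a1 ∧ a1 < b1
      · refine ⟨a0, b0, a1, b1, ?_⟩
        refine ⟨by omega, by omega, by omega, by omega, by omega, by omega, by omega, by omega, ?_⟩
        rintro p q hp
        split_ifs <;> omega
      by_cases c3 : a1 ≤ b0
      · refine ⟨a0, a1, b0, b1, ?_⟩
        refine ⟨by omega, by omega, by omega, by omega, by omega, by omega, by omega, by omega, ?_⟩
        rintro p q hp
        split_ifs <;> omega
      · refine ⟨a0, b1, b0, a1, ?_⟩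
        refine ⟨by omega, by omega, by omega, by omega, by omega, by omega, by omega, by omega, ?_⟩
        rintro p q hp
        split_ifs <;> omega
    · by_cases c2 : a0 < b0
      · refine ⟨a0, b1, b0, a1, ?_⟩
        refine ⟨by omega, by omega, by omega, by omega, by omega, by omega, by omega, by omega, ?_⟩
        rintro p q hp
        split_ifs <;> omega
      by_cases c3 : b0 < a0 ∧ a0 < b1
      · refine ⟨b0, a0, b1, a1, ?_⟩
        refine ⟨by omega, by omega, by omega, by omega, by omega, by omega, by omega, by omega, ?_⟩
        rintro p q hp
        split_ifs <;> omega
      · refine ⟨b0, b1, a0, a1, ?_⟩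
        refine ⟨by omega, by omega, by omega, by omega, by omega, by omega, by omega, by omega, ?_⟩
        rintro p q hp
        split_ifs <;> omega
  · by_cases c1 : ℓ < a0
    · by_cases c2 : a0 < b1 ∧ b1 < a1
      · refine ⟨b0, a0, b1, a1, ?_⟩
        refine ⟨by omega, by omega, by omega, by omega, by omega, by omega, by omega, by omega, ?_⟩
        rintro p q hp
        split_ifs <;> omega
      by_cases c3 : b1 ≤ a0
      · refine ⟨b0, b1, a0, a1, ?_⟩
        refine ⟨by omega, by omega, by omega, by omega, by omega, by omega, by omega, by omega, ?_⟩
        rintro p q hp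
        split_ifs <;> omega
      · refine ⟨b0, a1, a0, b1, ?_⟩
        refine ⟨by omega, by omega, by omega, by omega, by omega, by omega, by omega, by omega, ?_⟩
        rintro p q hp
        split_ifs <;> omega
    · by_cases c2 : b0 < a0
      · refine ⟨b0, a1, a0, b1, ?_⟩
        refine ⟨by omega, by omega, by omega, by omega, by omega, by omega, by omega, by omega, ?_⟩
        rintro p q hp
        split_ifs <;> omega
      by_cases c3 : a0 < b0 ∧ b0 < a1
      · refine ⟨a0, b0, a1, b1, ?_⟩
        refine ⟨by omega, by omega, by omega, by omega, by omega, by omega, by omega, by omega, ?_⟩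
        rintro p q hp
        split_ifs <;> omega
      · refine ⟨a0, a1, b0, b1, ?_⟩
        refine ⟨by omega, by omega, by omega, by omega, by omega, by omega, by omega, by omega, ?_⟩
        rintro p q hp
        split_ifs <;> omega
  · refine ⟨(min a0 b0), (min a1 b1), (max a0 b0), (max a1 b1), ?_⟩
    refine ⟨by omega, by omega, by omega, by omega, by omega, by omega, by omega, by omega, ?_⟩
    rintro p q hp
    split_ifs <;> omega

theorem gamma_inj {n k ℓ : ℕ} {I J A B : Fin k → ℕ} (hT : SSYT n k I J) (hT' : SSYT n k A B)
    (he : ∀ s, PairEq (rowArrange ℓ (Gamma ℓ I J).1 s) (rowArrange ℓ (Gamma ℓ I J).2 s)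
      (rowArrange ℓ (Gamma ℓ A B).1 s) (rowArrange ℓ (Gamma ℓ A B).2 s)) : I = A ∧ J = B := by
  have hg := gamma_idx (ℓ := ℓ) hT
  have hg' := gamma_idx (ℓ := ℓ) hT'
  obtain ⟨hI, hJ, hle⟩ := hT
  obtain ⟨hA, hB, hle'⟩ := hT'
  by_cases h : 2 ≤ k
  · have i01 : I ⟨0, by omega⟩ < I ⟨1, by omega⟩ := hI.1 (by simp [Fin.lt_def])
    have j01 : J ⟨0, by omega⟩ < J ⟨1, by omega⟩ := hJ.1 (by simp [Fin.lt_def])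
    have a01 : A ⟨0, by omega⟩ < A ⟨1, by omega⟩ := hA.1 (by simp [Fin.lt_def])
    have b01 : B ⟨0, by omega⟩ < B ⟨1, by omega⟩ := hB.1 (by simp [Fin.lt_def])
    have e0 := he ⟨0, by omega⟩
    have e1 := he ⟨1, by omega⟩
    rw [ra_zero h hg.1, ra_zero h hg.2, ra_zero h hg'.1, ra_zero h hg'.2] at e0
    rw [ra_fst h hg.1, ra_fst h hg.2, ra_fst h hg'.1, ra_fst h hg'.2] at e1
    simp only [gamma_fst h, gamma_snd h, and_true, one_ne_zero, and_false, if_false] at e0 e1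
    have key := num_inj ℓ _ _ _ _ _ _ _ _ i01 j01 (hle _) (hle _) a01 b01 (hle' _) (hle' _)
      _ _ _ _ rfl rfl rfl rfl e0 e1
    have main : ∀ s, I s = A s ∧ J s = B s := by
      intro s
      by_cases s0 : (s : ℕ) = 0
      · obtain rfl : s = ⟨0, Nat.lt_of_lt_of_le Nat.zero_lt_two h⟩ := Fin.ext s0
        exact ⟨key.1, key.2.2.1⟩
      by_cases s1 : (s : ℕ) = 1
      · obtain rfl : s = ⟨1, Nat.lt_of_lt_of_le Nat.one_lt_two h⟩ := Fin.ext s1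
        exact ⟨key.2.1, key.2.2.2⟩
      have e := he s
      rw [ra_high _ s (by omega), ra_high _ s (by omega), ra_high _ s (by omega),
        ra_high _ s (by omega)] at e
      simp only [gamma_fst h, gamma_snd h, s0, and_false, if_false] at e
      have := hle s
      have := hle' s
      unfold PairEq at e
      omega
    exact ⟨funext fun s => (main s).1, funext fun s => (main s).2⟩
  · have main : ∀ s, I s = A s ∧ J s = B s := by
      intro s
      have e := he s
      rw [gamma_one h, gamma_one h] at e
      simp only [ra_one h] at e
      have := hle s
      have := hle' s
      unfold PairEq at e
      omega
    exact ⟨funext fun s => (main s).1, funext fun s => (main s).2⟩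

theorem idx_build {n k : ℕ} (h : 2 ≤ k) (i0 i1 : ℕ) (M : Fin k → ℕ) (hM : IsIdx n k M)
    (h1 : 1 ≤ i0) (h01 : i0 < i1) (hi : i1 ≤ M ⟨1, by omega⟩) :
    IsIdx n k (fun s => if (s : ℕ) = 0 then i0 else if (s : ℕ) = 1 then i1 else M s) := by
  have hm : ∀ s : Fin k, 2 ≤ (s : ℕ) → i1 < M s := fun s hs =>
    hi.trans_lt (hM.1 (by simp [Fin.lt_def]; omega))
  have hb := hM.2 ⟨1, by omega⟩
  constructor
  · intro s t hst
    rw [Fin.lt_def] at hst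
    have h2 := hm t
    have h3 := @hM.1 s t hst
    dsimp only
    split_ifs <;> omega
  · intro s
    have := hM.2 s
    dsimp only
    split_ifs <;> omega

theorem gamma_ex {n k ℓ : ℕ} {A B : Fin k → ℕ} (hA : IsIdx n k A) (hB : IsIdx n k B) :
    ∃ I J, SSYT n k I J ∧ ∀ s, PairEq (rowArrange ℓ A s) (rowArrange ℓ B s)
      (rowArrange ℓ (Gamma ℓ I J).1 s) (rowArrange ℓ (Gamma ℓ I J).2 s) := by
  have hmin : IsIdx n k (fun s => min (A s) (B s)) := by
    refine ⟨fun s t hst => ?_, fun s => ?_⟩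
    · have := hA.1 hst; have := hB.1 hst; dsimp only; omega
    · have := hA.2 s; have := hB.2 s; dsimp only; omega
  have hmax : IsIdx n k (fun s => max (A s) (B s)) := by
    refine ⟨fun s t hst => ?_, fun s => ?_⟩
    · have := hA.1 hst; have := hB.1 hst; dsimp only; omega
    · have := hA.2 s; have := hB.2 s; dsimp only; omega
  by_cases h : 2 ≤ k
  · have a01 : A ⟨0, by omega⟩ < A ⟨1, by omega⟩ := hA.1 (by simp [Fin.lt_def])
    have b01 : B ⟨0, by omega⟩ < B ⟨1, by omega⟩ := hB.1 (by simp [Fin.lt_def])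
    obtain ⟨i0, i1, j0, j1, p1, p2, p3, p4, p5, p6, p7, p8, hp⟩ :=
      num_ex ℓ _ _ _ _ a01 b01 (hA.2 _).1 (hB.2 _).1
    have hp := hp (if GC ℓ i0 i1 j0 j1 then j0 else i0) (if GC ℓ i0 i1 j0 j1 then i0 else j0)
      (by split_ifs with hc <;> simp [hc])
    have hT : SSYT n k
      (fun s => if (s : ℕ) = 0 then i0 else if (s : ℕ) = 1 then i1 else min (A s) (B s))
      (fun s => if (s : ℕ) = 0 then j0 else if (s : ℕ) = 1 then j1 else max (A s) (B s)) := by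
      refine ⟨idx_build h i0 i1 _ hmin p1 p2 (le_min p6 p7),
        idx_build h j0 j1 _ hmax (p1.trans p4) p3 p8, fun s => ?_⟩
      dsimp only
      split_ifs <;> omega
    refine ⟨_, _, hT, fun s => ?_⟩
    have hg := gamma_idx (ℓ := ℓ) hT
    by_cases s0 : (s : ℕ) = 0
    · obtain rfl : s = ⟨0, Nat.lt_of_lt_of_le Nat.zero_lt_two h⟩ := Fin.ext s0
      rw [ra_zero h hg.1, ra_zero h hg.2, ra_zero h hA, ra_zero h hB]
      simp only [gamma_fst h, gamma_snd h, and_true, one_ne_zero, and_false, if_false, if_true]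
      exact hp.1
    by_cases s1 : (s : ℕ) = 1
    · obtain rfl : s = ⟨1, Nat.lt_of_lt_of_le Nat.one_lt_two h⟩ := Fin.ext s1
      rw [ra_fst h hg.1, ra_fst h hg.2, ra_fst h hA, ra_fst h hB]
      simp only [gamma_fst h, gamma_snd h, and_true, one_ne_zero, and_false, if_false, if_true]
      exact hp.2
    rw [ra_high _ s (by omega), ra_high _ s (by omega), ra_high _ s (by omega),
        ra_high _ s (by omega)]
    simp only [gamma_fst h, gamma_snd h, s0, s1, and_false, if_false]
    unfold PairEq
    omega
  · refine ⟨_, _, ⟨hmin, hmax, fun s => ?_⟩, fun s => ?_⟩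
    · omega
    · rw [gamma_one h]
      simp only [ra_one h]
      unfold PairEq
      omega

theorem mem_T {K : Type*} [Field K] {n k ℓ : ℕ} {T : Set (PlVar n k)}
    (hmf : MonomialFree (restrictIdeal (RingHom.ker (phiMF K n k ℓ)) T))
    (A B : T) (C D : PlVar n k)
    (he : phiMF K n k ℓ (X A.1 * X B.1) = phiMF K n k ℓ (X C * X D)) : C ∈ T ∧ D ∈ T := by
  by_contra hc
  apply hmf (Finsupp.single A 1 + Finsupp.single B 1)
  have h1 : (monomial (Finsupp.single A 1 + Finsupp.single B 1) (1 : K)) = X A * X B := by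
    simp [X, monomial_mul]
  rw [h1, restrictIdeal, Ideal.mem_comap]
  simp only [map_mul, rename_X]
  have h2 : (X A.1 * X B.1 : MvPolynomial (PlVar n k) K) =
      (X A.1 * X B.1 - X C * X D) + X C * X D := by ring
  rw [h2]
  refine Submodule.add_mem_sup ?_ ?_
  · rw [RingHom.mem_ker, map_sub, sub_eq_zero]; exact he
  · by_cases hC : C ∈ T
    · exact Ideal.mul_mem_left _ _ (Ideal.subset_span ⟨D, fun hD => hc ⟨hC, hD⟩, rfl⟩)
    · exact Ideal.mul_mem_right _ _ (Ideal.subset_span ⟨C, hC, rfl⟩)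

/-- Suppose `G_{k,n,ℓ}|_w^v` is monomial-free. Then the images in
`K[P_I : I ∈ T_w^v] / ker(φ_ℓ|_w^v)` of the degree-two monomials `P_{I'} P_{J'}`, where
`(I', J') = Γ_ℓ(I, J)` ranges over all two-column semi-standard Young tableaux `(I, J)`
with `v ≤ I, J ≤ w`, form a `K`-linearly independent set, and every homogeneous degree-two
polynomial is congruent modulo `ker(φ_ℓ|_w^v)` to a `K`-linear combination of them. -/
theorem statement_14 (K : Type*) [Field K] (n k ℓ : ℕ) (hk : 0 < k) (hkn : k < n)
    (hℓ1 : 1 ≤ ℓ) (hℓ2 : ℓ ≤ n - 1)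
    (v w : PlVar n k) (hvw : TupLe v.val w.val)
    (hmf : MonomialFree (restrictIdeal (RingHom.ker (phiMF K n k ℓ)) (TWV v w))) :
    ∃ f : {p : (Fin k → ℕ) × (Fin k → ℕ) //
            SSYT n k p.1 p.2 ∧ TupLe v.val p.1 ∧ TupLe p.1 w.val ∧
              TupLe v.val p.2 ∧ TupLe p.2 w.val} →
          (TWV v w) × (TWV v w),
      (∀ T, ((f T).1 : PlVar n k).val = (Gamma ℓ T.val.1 T.val.2).1 ∧
            ((f T).2 : PlVar n k).val = (Gamma ℓ T.val.1 T.val.2).2) ∧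
      LinearIndependent K
        (fun T => Ideal.Quotient.mk (kerPhiRes K n k ℓ (TWV v w))
          (X (f T).1 * X (f T).2)) ∧
      (∀ g : MvPolynomial (TWV v w) K, g.IsHomogeneous 2 →
        Ideal.Quotient.mk (kerPhiRes K n k ℓ (TWV v w)) g ∈
          Submodule.span K (Set.range fun T =>
            Ideal.Quotient.mk (kerPhiRes K n k ℓ (TWV v w))
              (X (f T).1 * X (f T).2))) := by
  have hTpair : ∀ (I J A B : Fin k → ℕ), (∀ s, PairEq (A s) (B s) (I s) (J s)) →
      TupLe v.val I ∧ TupLe I w.val ∧ TupLe v.val J ∧ TupLe J w.val →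
      (TupLe v.val A ∧ TupLe A w.val) ∧ (TupLe v.val B ∧ TupLe B w.val) := by
    rintro I J A B hp ⟨h1, h2, h3, h4⟩
    refine ⟨⟨fun s => ?_, fun s => ?_⟩, ⟨fun s => ?_, fun s => ?_⟩⟩ <;>
    · have := hp s; have := h1 s; have := h2 s; have := h3 s; have := h4 s
      unfold PairEq at *
      omega
  let f : {p : (Fin k → ℕ) × (Fin k → ℕ) //
            SSYT n k p.1 p.2 ∧ TupLe v.val p.1 ∧ TupLe p.1 w.val ∧
              TupLe v.val p.2 ∧ TupLe p.2 w.val} → (TWV v w) × (TWV v w) := fun T =>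
    (⟨⟨(Gamma ℓ T.val.1 T.val.2).1, (gamma_idx T.2.1).1⟩,
        (hTpair _ _ _ _ (gamma_pair _ _) T.2.2).1⟩,
      ⟨⟨(Gamma ℓ T.val.1 T.val.2).2, (gamma_idx T.2.1).2⟩,
        (hTpair _ _ _ _ (gamma_pair _ _) T.2.2).2⟩)
  have hphi : ∀ A B : PlVar n k, phiMF K n k ℓ (X A * X B) =
      monomial (expo ℓ A.val + expo ℓ B.val) 1 := by
    intro A B
    rw [map_mul, phi_X, phi_X, monomial_mul, one_mul]
  refine ⟨f, fun T => ⟨rfl, rfl⟩, ?_, ?_⟩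
  · let ψ := Ideal.Quotient.liftₐ (kerPhiRes K n k ℓ (TWV v w))
      ((phiMF K n k ℓ).comp (rename fun x : TWV v w => (x : PlVar n k))) (fun a ha => ha)
    apply LinearIndependent.of_comp ψ.toLinearMap
    have hcomp : (ψ.toLinearMap ∘ fun T => Ideal.Quotient.mk (kerPhiRes K n k ℓ (TWV v w))
          (X (f T).1 * X (f T).2)) =
        (basisMonomials (ℕ × ℕ) K) ∘ fun T =>
          expo ℓ (f T).1.1.val + expo ℓ (f T).2.1.val := by
      funext T
      have : ψ (Ideal.Quotient.mk (kerPhiRes K n k ℓ (TWV v w)) (X (f T).1 * X (f T).2)) =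
          phiMF K n k ℓ (rename (fun x : TWV v w => (x : PlVar n k)) (X (f T).1 * X (f T).2)) :=
        rfl
      simp only [Function.comp_apply, AlgHom.toLinearMap_apply, this, coe_basisMonomials]
      rw [map_mul (rename _), rename_X, rename_X, hphi]
    rw [hcomp]
    apply (basisMonomials (ℕ × ℕ) K).linearIndependent.comp
    intro T T' hTT
    have := gamma_inj T.2.1 T'.2.1 (expo_add_eq.1 hTT)
    exact Subtype.ext (Prod.ext this.1 this.2)
  · have hmono : ∀ A B : TWV v w, ∃ T, Ideal.Quotient.mk (kerPhiRes K n k ℓ (TWV v w)) (X A * X B)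
        = Ideal.Quotient.mk (kerPhiRes K n k ℓ (TWV v w)) (X (f T).1 * X (f T).2) := by
      intro A B
      obtain ⟨I, J, hT, hp⟩ := gamma_ex (ℓ := ℓ) A.1.2 B.1.2
      have hg := gamma_idx (ℓ := ℓ) hT
      have he : phiMF K n k ℓ (X A.1 * X B.1) =
          phiMF K n k ℓ (X ⟨(Gamma ℓ I J).1, hg.1⟩ * X ⟨(Gamma ℓ I J).2, hg.2⟩) := by
        refine (hphi _ _).trans (Eq.trans ?_ (hphi _ _).symm)
        exact congrArg (fun m => monomial m (1 : K)) (expo_add_eq.2 hp)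
      obtain ⟨hC, hD⟩ := mem_T hmf A B _ _ he
      have hIJ := hTpair (Gamma ℓ I J).1 (Gamma ℓ I J).2 I J (fun s => by
        have := gamma_pair (ℓ := ℓ) I J s
        unfold PairEq at *
        omega) ⟨hC.1, hC.2, hD.1, hD.2⟩
      refine ⟨⟨(I, J), hT, hIJ.1.1, hIJ.1.2, hIJ.2.1, hIJ.2.2⟩, ?_⟩
      rw [Ideal.Quotient.eq, kerPhiRes, RingHom.mem_ker, map_sub, sub_eq_zero]
      simp only [AlgHom.comp_apply, map_mul (rename _), rename_X]
      exact he
    intro g hg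
    rw [g.as_sum, map_sum]
    refine Submodule.sum_mem _ fun m hm => ?_
    have hdeg : m.degree = 2 := by
      have := hg (mem_support_iff.1 hm)
      rw [Finsupp.degree_eq_weight_one]
      exact this
    obtain ⟨A, B, rfl⟩ : ∃ A B, m = Finsupp.single A 1 + Finsupp.single B 1 := by
      classical
      have hc : (Finsupp.toMultiset m).card = 2 := by
        rw [Finsupp.card_toMultiset]; exact hdeg
      obtain ⟨A, B, hAB⟩ := Multiset.card_eq_two.1 hc
      refine ⟨A, B, (Finsupp.orderIsoMultiset (ι := TWV v w)).injective ?_⟩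
      change Finsupp.toMultiset m = Finsupp.toMultiset _
      rw [hAB, map_add, Finsupp.toMultiset_single, Finsupp.toMultiset_single]
      simp
    obtain ⟨T, hT⟩ := hmono A B
    have h1 : (monomial (Finsupp.single A 1 + Finsupp.single B 1)
        (coeff (Finsupp.single A 1 + Finsupp.single B 1) g)) =
        (coeff (Finsupp.single A 1 + Finsupp.single B 1) g) • (X A * X B) := by
      simp [X, monomial_mul, smul_monomial]
    have h2 : ∀ (c : K) (p : MvPolynomial (TWV v w) K),
        Ideal.Quotient.mk (kerPhiRes K n k ℓ (TWV v w)) (c • p) =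
        c • Ideal.Quotient.mk (kerPhiRes K n k ℓ (TWV v w)) p := fun _ _ => rfl
    rw [h1, h2, hT]
    exact Submodule.smul_mem _ _ (Submodule.subset_span ⟨T, rfl⟩)
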